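/- arXiv:0904.0990 — 4 statements merged into one kernel-verified Lean document; each statement's English description precedes it below -/
import Mathlib

section
/- Let n ≥ 3, r > 0, and let f be a C² real-valued function on the closed ball B̄_r ⊂ ℝⁿ whose graph has negative Ricci curvature at every point, i.e. for every x ∈ B̄_r, every eigenvalue k of W(x) satisfies k·(tr W(x) − k) < 0. Then inf_{x∈B̄_r} |A|(x) < 3(n−2)/r, where |A|(x) = √(tr(W(x)²)) is the length of the second fundamental form. -/
open Metric Finset

/-- Coordinates of the gradient of `f` at `x`. -/
noncomputable def grad (n : ℕ) (f : EuclideanSpace ℝ (Fin n) → ℝ)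
    (x : EuclideanSpace ℝ (Fin n)) : Fin n → ℝ :=
  fun i => fderiv ℝ f x (EuclideanSpace.single i 1)

/-- The Hessian matrix `D²f(x)`. -/
noncomputable def hess (n : ℕ) (f : EuclideanSpace ℝ (Fin n) → ℝ)
    (x : EuclideanSpace ℝ (Fin n)) : Matrix (Fin n) (Fin n) ℝ :=
  Matrix.of fun i j =>
    fderiv ℝ (fun y => fderiv ℝ f y (EuclideanSpace.single j 1)) x (EuclideanSpace.single i 1)

/-- `|∇f(x)|²`. -/
noncomputable def gradSq (n : ℕ) (f : EuclideanSpace ℝ (Fin n) → ℝ)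
    (x : EuclideanSpace ℝ (Fin n)) : ℝ :=
  ∑ i, grad n f x i ^ 2

/-- The shape operator of the graph of `f`, with respect to the upward unit normal:
`W(x) = (1+|∇f|²)^{-1/2} (Iₙ - ∇f ∇fᵀ/(1+|∇f|²)) D²f(x)`. -/
noncomputable def shapeOp (n : ℕ) (f : EuclideanSpace ℝ (Fin n) → ℝ)
    (x : EuclideanSpace ℝ (Fin n)) : Matrix (Fin n) (Fin n) ℝ :=
  (Real.sqrt (1 + gradSq n f x))⁻¹ •
    (((1 : Matrix (Fin n) (Fin n) ℝ) -
      Matrix.of fun i j => grad n f x i * grad n f x j / (1 + gradSq n f x)) * hess n f x)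

/-- The mean curvature `H(x) = tr W(x) / n`. -/
noncomputable def meanCurv (n : ℕ) (f : EuclideanSpace ℝ (Fin n) → ℝ)
    (x : EuclideanSpace ℝ (Fin n)) : ℝ :=
  (shapeOp n f x).trace / n

/-- The scalar curvature `R(x) = ((tr W)² - tr(W²)) / (n(n-1))`. -/
noncomputable def scalarCurv (n : ℕ) (f : EuclideanSpace ℝ (Fin n) → ℝ)
    (x : EuclideanSpace ℝ (Fin n)) : ℝ :=
  ((shapeOp n f x).trace ^ 2 - (shapeOp n f x * shapeOp n f x).trace) /
    ((n : ℝ) * ((n : ℝ) - 1))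

/-- The length `|A|(x) = √(tr(W(x)²))` of the second fundamental form. -/
noncomputable def normA (n : ℕ) (f : EuclideanSpace ℝ (Fin n) → ℝ)
    (x : EuclideanSpace ℝ (Fin n)) : ℝ :=
  Real.sqrt ((shapeOp n f x * shapeOp n f x).trace)

open Matrix Filter Topology

lemma exists_orthogonal_diagonalization {n : ℕ} {A : Matrix (Fin n) (Fin n) ℝ}
    (hA : Aᵀ = A) : ∃ (U : Matrix (Fin n) (Fin n) ℝ) (d : Fin n → ℝ),
      U * Uᵀ = 1 ∧ Uᵀ * A * U = diagonal d := by
  have hH : A.IsHermitian := by simpa [Matrix.IsHermitian, conjTranspose_eq_transpose_of_trivial]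
  refine ⟨hH.eigenvectorUnitary, hH.eigenvalues, ?_, ?_⟩
  · have := Unitary.coe_mul_star_self hH.eigenvectorUnitary
    simpa [star_eq_conjTranspose, conjTranspose_eq_transpose_of_trivial] using this
  · have := hH.conjStarAlgAut_star_eigenvectorUnitary
    simpa [Unitary.conjStarAlgAut_apply, star_eq_conjTranspose,
      conjTranspose_eq_transpose_of_trivial, Function.comp_def] using this

/-- Simultaneous diagonalization of a positive definite and a symmetric matrix. -/
lemma exists_simultaneous_diagonalization {n : ℕ} {P B : Matrix (Fin n) (Fin n) ℝ}
    (hP : P.PosDef) (hB : Bᵀ = B) : ∃ (V : Matrix (Fin n) (Fin n) ℝ) (k : Fin n → ℝ),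
      IsUnit V ∧ V * Vᵀ = P ∧ Vᵀ * B * V = diagonal k := by
  obtain ⟨C, hC⟩ : ∃ C : Matrix (Fin n) (Fin n) ℝ, C * Cᵀ = P := by
    have hPt : Pᵀ = P := by
      simpa [conjTranspose_eq_transpose_of_trivial] using hP.isHermitian.eq
    obtain ⟨U, d, hU, hd⟩ := exists_orthogonal_diagonalization hPt
    have hU' : Uᵀ * U = 1 := mul_eq_one_comm.mp hU
    have hPd : P = U * diagonal d * Uᵀ := by
      rw [← hd]
      calc P = (U * Uᵀ) * P * (U * Uᵀ) := by simp [hU]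
        _ = _ := by simp only [Matrix.mul_assoc]
    have hdpos : ∀ i, 0 ≤ d i := fun i => by
      have h := (hP.posSemidef.conjTranspose_mul_mul_same U).diag_nonneg (i := i)
      rw [conjTranspose_eq_transpose_of_trivial, hd] at h
      simpa using h
    refine ⟨U * diagonal (fun i => √(d i)), ?_⟩
    have hs : diagonal (fun i => √(d i)) * diagonal (fun i => √(d i)) = diagonal d := by
      simp [diagonal_mul_diagonal, Real.mul_self_sqrt, hdpos]
    rw [hPd, ← hs]
    simp only [transpose_mul, diagonal_transpose, Matrix.mul_assoc]
  obtain ⟨U, k, hU, hk⟩ := exists_orthogonal_diagonalization (A := Cᵀ * B * C)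
    (by simp [transpose_mul, hB, Matrix.mul_assoc])
  have hV : (C * U) * (C * U)ᵀ = P := by
    rw [transpose_mul, Matrix.mul_assoc, ← Matrix.mul_assoc U, hU, Matrix.one_mul, hC]
  refine ⟨C * U, k, ?_, hV, ?_⟩
  · have h : IsUnit ((C * U).det * (C * U)ᵀ.det) := by
      rw [← det_mul, hV]; exact hP.det_pos.ne'.isUnit
    exact (isUnit_iff_isUnit_det _).mpr (isUnit_of_mul_isUnit_left h)
  · rw [← hk, transpose_mul]; simp only [Matrix.mul_assoc]

/-- A spectral frame for `P * B`: a basis `V` in which `B` is diagonal with the eigenvalues of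
`P * B` as entries. -/
lemma exists_spectral_frame {n : ℕ} {P B : Matrix (Fin n) (Fin n) ℝ}
    (hP : P.PosDef) (hB : Bᵀ = B) : ∃ (V : Matrix (Fin n) (Fin n) ℝ) (k : Fin n → ℝ),
      IsUnit V ∧ Vᵀ * B * V = diagonal k ∧
      (∀ i, V.col i ≠ 0 ∧ (P * B) *ᵥ V.col i = k i • V.col i) ∧
      (P * B).trace = ∑ i, k i ∧ (P * B * (P * B)).trace = ∑ i, k i ^ 2 := by
  obtain ⟨V, k, hV, hVP, hVB⟩ := exists_simultaneous_diagonalization hP hB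
  have hmul : P * B * V = V * diagonal k := by
    rw [← hVP, ← hVB]; simp only [Matrix.mul_assoc]
  refine ⟨V, k, hV, hVB, fun i => ⟨fun h => ?_, ?_⟩, ?_, ?_⟩
  · have h0 : V *ᵥ Pi.single i 1 = V *ᵥ 0 := by simpa using h
    have := (mulVec_injective_iff_isUnit.mpr hV) h0
    simpa using congrFun this i
  · rw [← mulVec_single_one, mulVec_mulVec, hmul, ← mulVec_mulVec]
    rw [← mulVec_smul]
    congr 1
    ext j
    by_cases h : j = i
    · subst h; simp [mulVec_diagonal]
    · simp [mulVec_diagonal, h]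
  · rw [← hVP, Matrix.mul_assoc, trace_mul_comm, hVB, trace_diagonal]
  · have : P * B * (P * B) = V * (Vᵀ * B * V * (Vᵀ * B)) := by
      rw [← hVP]; simp only [Matrix.mul_assoc]
    rw [this, trace_mul_comm, Matrix.mul_assoc, hVB, diagonal_mul_diagonal, trace_diagonal]
    simp [sq]

lemma sum_sq_lt_of_two_neg {n : ℕ} {s : ℝ} (hs : 0 < s) (k : Fin n → ℝ)
    (hle : ∀ i, k i ≤ s) (hk : ∀ i, k i * (∑ j, k j - k i) < 0)
    {a b : Fin n} (hab : a ≠ b) (ha : k a < 0) (hb : k b < 0) :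
    √(∑ i, k i ^ 2) < 3 * ((n : ℝ) - 2) * s := by
  set S := ∑ j, k j with hS
  have hSa : k a < S := by nlinarith [hk a]
  have hSb : k b < S := by nlinarith [hk b]
  set σ := ∑ i, max (k i) 0 with hσ
  have hcard : ((univ \ {a, b} : Finset (Fin n)).card : ℝ) = n - 2 := by
    rw [cast_card_sdiff (subset_univ _), card_pair hab]; simp
  have hsplit : ∀ g : Fin n → ℝ, ∑ i, g i = ∑ i ∈ univ \ {a, b}, g i + (g a + g b) := fun g => by
    rw [← sum_pair hab, sum_sdiff (subset_univ _)]
  have hσle : σ ≤ (n - 2) * s := by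
    rw [hσ, hsplit, max_eq_right ha.le, max_eq_right hb.le, ← hcard, ← nsmul_eq_mul]
    simpa using sum_le_card_nsmul (univ \ {a, b}) (fun i => max (k i) 0) s
      fun i _ => max_le (hle i) hs.le
  have hSle : S ≤ σ + (k a + k b) := by
    rw [hS, hσ, hsplit k, hsplit fun i => max (k i) 0, max_eq_right ha.le, max_eq_right hb.le]
    have := sum_le_sum fun i (_ : i ∈ univ \ {a, b}) => le_max_left (k i) 0
    linarith
  have habs : ∑ i, |k i| = 2 * σ - S := by
    rw [hσ, hS, mul_sum, ← sum_sub_distrib]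
    refine sum_congr rfl fun i _ => ?_
    rcases le_total (k i) 0 with h | h
    · rw [abs_of_nonpos h, max_eq_right h]; ring
    · rw [abs_of_nonneg h, max_eq_left h]; ring
  calc √(∑ i, k i ^ 2) ≤ ∑ i, |k i| := by
        refine Real.sqrt_le_iff.mpr ⟨sum_nonneg fun i _ => abs_nonneg _, ?_⟩
        simpa using sum_sq_le_sq_sum_of_nonneg (s := univ) (f := fun i => |k i|)
          fun i _ => abs_nonneg _
    _ < 3 * σ := by rw [habs]; linarith
    _ ≤ _ := by linarith

lemma fderiv_eq_grad_dotProduct {n : ℕ} (f : EuclideanSpace ℝ (Fin n) → ℝ)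
    (x v : EuclideanSpace ℝ (Fin n)) : fderiv ℝ f x v = grad n f x ⬝ᵥ v.ofLp := by
  conv_lhs => rw [← (EuclideanSpace.basisFun (Fin n) ℝ).sum_repr v]
  simp [dotProduct, grad, mul_comm]

lemma hess_apply {n : ℕ} {f : EuclideanSpace ℝ (Fin n) → ℝ} (hf : ContDiff ℝ 2 f)
    (x : EuclideanSpace ℝ (Fin n)) (i j : Fin n) :
    hess n f x i j =
      fderiv ℝ (fderiv ℝ f) x (EuclideanSpace.single i 1) (EuclideanSpace.single j 1) := by
  have h : DifferentiableAt ℝ (fderiv ℝ f) x :=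
    (hf.fderiv_right (m := 1) (by norm_num)).differentiable (by norm_num) x
  simp [hess, fderiv_clm_apply h (differentiableAt_const _)]

lemma hess_transpose {n : ℕ} {f : EuclideanSpace ℝ (Fin n) → ℝ} (hf : ContDiff ℝ 2 f)
    (x : EuclideanSpace ℝ (Fin n)) : (hess n f x)ᵀ = hess n f x := by
  ext i j
  rw [transpose_apply, hess_apply hf, hess_apply hf]
  exact (hf.contDiffAt.isSymmSndFDerivAt (by simp)).eq _ _

lemma continuous_hess {n : ℕ} {f : EuclideanSpace ℝ (Fin n) → ℝ} (hf : ContDiff ℝ 2 f) :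
    Continuous (hess n f) := by
  have h : Continuous (fderiv ℝ (fderiv ℝ f)) :=
    (hf.fderiv_right (m := 1) (by norm_num)).continuous_fderiv (by norm_num)
  refine continuous_matrix fun i j => ?_
  simp only [hess_apply hf]
  fun_prop

lemma fderiv_fderiv_eq_hess {n : ℕ} {f : EuclideanSpace ℝ (Fin n) → ℝ} (hf : ContDiff ℝ 2 f)
    (x v : EuclideanSpace ℝ (Fin n)) :
    fderiv ℝ (fderiv ℝ f) x v v = v.ofLp ⬝ᵥ hess n f x *ᵥ v.ofLp := by
  conv_lhs => rw [← (EuclideanSpace.basisFun (Fin n) ℝ).sum_repr v]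
  simp [dotProduct, mulVec, hess_apply hf, Finset.mul_sum, mul_comm]
  rw [sum_comm]
  exact sum_congr rfl fun i _ => sum_congr rfl fun j _ => by ring

lemma shapeOp_neg {n : ℕ} (f : EuclideanSpace ℝ (Fin n) → ℝ) (x : EuclideanSpace ℝ (Fin n)) :
    shapeOp n (-f) x = -shapeOp n f x := by
  have hg : grad n (-f) x = -grad n f x := by ext i; simp [grad, fderiv_neg]
  have hh : hess n (-f) x = -hess n f x := by
    ext i j
    simp only [hess, of_apply, fderiv_neg, _root_.neg_apply]
    rw [fderiv_fun_neg]; rfl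
  simp [shapeOp, gradSq, hg, hh]

lemma gradSq_nonneg {n : ℕ} (f : EuclideanSpace ℝ (Fin n) → ℝ) (x : EuclideanSpace ℝ (Fin n)) :
    0 ≤ gradSq n f x := sum_nonneg fun _ _ => sq_nonneg _

lemma gradSq_eq_dotProduct {n : ℕ} (f : EuclideanSpace ℝ (Fin n) → ℝ)
    (x : EuclideanSpace ℝ (Fin n)) : gradSq n f x = grad n f x ⬝ᵥ grad n f x := by
  simp [gradSq, dotProduct, sq]

/-- `Iₙ - u uᵀ / (1 + |u|²)` is positive definite. -/
lemma posDef_inverse_metric {n : ℕ} (u : Fin n → ℝ) {c : ℝ} (hc : 0 < c) :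
    (c • ((1 : Matrix (Fin n) (Fin n) ℝ) -
      Matrix.of fun i j => u i * u j / (1 + ∑ i, u i ^ 2))).PosDef := by
  set G := 1 + ∑ i, u i ^ 2 with hG
  have hGpos : 0 < G := by positivity
  have h : (Matrix.of fun i j => u i * u j / G) = G⁻¹ • vecMulVec u u := by
    ext i j; simp [vecMulVec_apply]; ring
  rw [h]
  refine .smul (.of_dotProduct_mulVec_pos ?_ fun v hv => ?_) hc
  · refine isHermitian_one.sub ?_
    ext i j; simp [vecMulVec_apply, mul_comm]
  · have hv' : 0 < v ⬝ᵥ v := by simpa using dotProduct_star_self_pos_iff.mpr hv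
    have hcs : (u ⬝ᵥ v) ^ 2 ≤ (∑ i, u i ^ 2) * (v ⬝ᵥ v) := by
      simpa [dotProduct, sq] using sum_mul_sq_le_sq_mul_sq univ u v
    simp only [star_trivial, sub_mulVec, one_mulVec, smul_mulVec, vecMulVec_mulVec,
      dotProduct_sub, dotProduct_smul]
    have : G⁻¹ * (u ⬝ᵥ v) ^ 2 < v ⬝ᵥ v := by
      rw [inv_mul_lt_iff₀ hGpos]; nlinarith
    simp only [dotProduct_comm v u, op_smul_eq_smul, smul_eq_mul, sub_pos]
    nlinarith

lemma exists_shapeOp_frame {n : ℕ} {f : EuclideanSpace ℝ (Fin n) → ℝ} (hf : ContDiff ℝ 2 f)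
    (x : EuclideanSpace ℝ (Fin n)) : ∃ (V : Matrix (Fin n) (Fin n) ℝ) (k : Fin n → ℝ),
      IsUnit V ∧ Vᵀ * hess n f x * V = diagonal k ∧
      (∀ i, V.col i ≠ 0 ∧ shapeOp n f x *ᵥ V.col i = k i • V.col i) ∧
      (shapeOp n f x).trace = ∑ i, k i ∧ normA n f x = √(∑ i, k i ^ 2) := by
  have hc : 0 < (√(1 + gradSq n f x))⁻¹ :=
    inv_pos.mpr (Real.sqrt_pos.mpr (by linarith [gradSq_nonneg f x]))
  obtain ⟨V, k, hV, hB, he, ht, hq⟩ :=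
    exists_spectral_frame (posDef_inverse_metric (grad n f x) hc) (hess_transpose hf x)
  rw [smul_mul_assoc] at he ht hq
  exact ⟨V, k, hV, hB, he, ht, congrArg Real.sqrt hq⟩

/-- The quadratic form of the Hessian on an eigenvector of the shape operator. -/
lemma hess_eigenvector {n : ℕ} {f : EuclideanSpace ℝ (Fin n) → ℝ} {x : EuclideanSpace ℝ (Fin n)}
    {k : ℝ} {v : Fin n → ℝ} (hv : shapeOp n f x *ᵥ v = k • v) :
    v ⬝ᵥ hess n f x *ᵥ v =
      √(1 + gradSq n f x) * k * (v ⬝ᵥ v + (grad n f x ⬝ᵥ v) ^ 2) := by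
  set u := grad n f x with hu
  set w := hess n f x *ᵥ v with hw
  set G := 1 + gradSq n f x with hG
  have hGpos : 0 < G := by linarith [gradSq_nonneg f x]
  have hsq : √G ≠ 0 := (Real.sqrt_pos.mpr hGpos).ne'
  have hmat : (Matrix.of fun i j => u i * u j / G) = G⁻¹ • vecMulVec u u := by
    ext i j; simp [vecMulVec_apply]; ring
  have h : w - (G⁻¹ * (u ⬝ᵥ w)) • u = (√G * k) • v := by
    have h1 : (√G)⁻¹ • (w - (G⁻¹ * (u ⬝ᵥ w)) • u) = k • v := by
      rw [← hv, shapeOp, ← hu, ← hG, hmat, smul_mulVec, ← mulVec_mulVec, ← hw, sub_mulVec,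
        smul_mulVec, vecMulVec_mulVec, one_mulVec, mul_smul]
      simp
    rw [mul_smul (√G) k v, ← h1, smul_inv_smul₀ hsq]
  have hvw := congrArg (v ⬝ᵥ ·) h
  have huw := congrArg (u ⬝ᵥ ·) h
  have huu : u ⬝ᵥ u = G - 1 := by rw [hG, gradSq_eq_dotProduct]; ring
  simp only [dotProduct_sub, dotProduct_smul, smul_eq_mul, huu, dotProduct_comm v u] at hvw huw
  have : G⁻¹ * (u ⬝ᵥ w) = √G * k * (u ⬝ᵥ v) := by
    rw [← huw]; field_simp; ring
  rw [this] at hvw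
  linarith

/-- A symmetric form that is negative definite on a plane is not positive definite
modulo a rank one term. -/
lemma not_neg_plane_of_posDef_add_sq {n : ℕ} {B : Matrix (Fin n) (Fin n) ℝ} (hB : Bᵀ = B)
    {l : Fin n → ℝ} (hl : ∀ z : Fin n → ℝ, z ≠ 0 → 0 < z ⬝ᵥ B *ᵥ z + (l ⬝ᵥ z) ^ 2)
    {a b : Fin n → ℝ} (ha : a ⬝ᵥ B *ᵥ a < 0)
    (hab : (a ⬝ᵥ B *ᵥ b) ^ 2 < (a ⬝ᵥ B *ᵥ a) * (b ⬝ᵥ B *ᵥ b)) : False := by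
  have hsymm : b ⬝ᵥ B *ᵥ a = a ⬝ᵥ B *ᵥ b := by
    rw [dotProduct_mulVec, ← mulVec_transpose, hB, dotProduct_comm]
  have hexp : ∀ s t : ℝ, (s • a + t • b) ⬝ᵥ B *ᵥ (s • a + t • b) =
      s ^ 2 * (a ⬝ᵥ B *ᵥ a) + 2 * s * t * (a ⬝ᵥ B *ᵥ b) + t ^ 2 * (b ⬝ᵥ B *ᵥ b) := fun s t => by
    simp only [mulVec_add, mulVec_smul, add_dotProduct, dotProduct_add, smul_dotProduct,
      dotProduct_smul, hsymm, smul_eq_mul]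
    ring
  have hneg : ∀ s t : ℝ, (s ≠ 0 ∨ t ≠ 0) →
      (s • a + t • b) ⬝ᵥ B *ᵥ (s • a + t • b) < 0 := fun s t hst => by
    rw [hexp]
    set α := a ⬝ᵥ B *ᵥ a
    set β := a ⬝ᵥ B *ᵥ b
    set γ := b ⬝ᵥ B *ᵥ b
    have key : 0 < α * (s ^ 2 * α + 2 * s * t * β + t ^ 2 * γ) := by
      have : α * (s ^ 2 * α + 2 * s * t * β + t ^ 2 * γ) =
          (s * α + t * β) ^ 2 + t ^ 2 * (α * γ - β ^ 2) := by ring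
      rw [this]
      have hd : 0 < α * γ - β ^ 2 := by linarith
      by_cases ht : t = 0
      · subst ht
        have hs : s ≠ 0 := by simpa using hst
        have := ha.ne
        simp only [zero_mul, add_zero, ne_eq, OfNat.ofNat_ne_zero, not_false_eq_true, zero_pow]
        positivity
      · positivity
    exact neg_of_mul_pos_right key ha.le
  obtain ⟨s, t, hst, hker⟩ : ∃ s t : ℝ, (s ≠ 0 ∨ t ≠ 0) ∧ l ⬝ᵥ (s • a + t • b) = 0 := by
    by_cases h : l ⬝ᵥ b = 0
    · exact ⟨0, 1, by simp, by simp [h]⟩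
    · refine ⟨l ⬝ᵥ b, -(l ⬝ᵥ a), Or.inl h, ?_⟩
      simp only [dotProduct_add, dotProduct_smul, smul_eq_mul]; ring
  have h1 := hneg s t hst
  have h2 := hl (s • a + t • b) (by rintro h; simp [h] at h1)
  rw [hker] at h2
  linarith

lemma isOpen_setOf_posDef_add_sq {X : Type*} [TopologicalSpace X] {n : ℕ}
    {B : X → Matrix (Fin n) (Fin n) ℝ} (hB : Continuous B) :
    IsOpen {x | ∃ l : Fin n → ℝ, ∀ z : Fin n → ℝ, z ≠ 0 →
      0 < z ⬝ᵥ B x *ᵥ z + (l ⬝ᵥ z) ^ 2} := by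
  rw [isOpen_iff_mem_nhds]
  rintro x ⟨l, hl⟩
  have hcont : Continuous fun p : X × (Fin n → ℝ) =>
      p.2 ⬝ᵥ B p.1 *ᵥ p.2 + (l ⬝ᵥ p.2) ^ 2 :=
    (continuous_snd.dotProduct ((hB.comp continuous_fst).matrix_mulVec continuous_snd)).add
      ((continuous_const.dotProduct continuous_snd).pow 2)
  have := (isCompact_sphere (0 : Fin n → ℝ) 1).eventually_forall_of_forall_eventually
    (x₀ := x) (P := fun y z => 0 < z ⬝ᵥ B y *ᵥ z + (l ⬝ᵥ z) ^ 2) fun z hz =>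
      hcont.continuousAt.eventually (lt_mem_nhds (hl z (ne_zero_of_mem_unit_sphere ⟨z, hz⟩)))
  filter_upwards [this] with y hy
  refine ⟨l, fun z hz => ?_⟩
  have hz' : 0 < ‖z‖ := norm_pos_iff.mpr hz
  have h := hy (‖z‖⁻¹ • z) (by simp [norm_smul, hz'.ne'])
  simp only [mulVec_smul, smul_dotProduct, dotProduct_smul, smul_eq_mul] at h
  have h2 : ‖z‖⁻¹ * (‖z‖⁻¹ * (z ⬝ᵥ B y *ᵥ z)) + (‖z‖⁻¹ * (l ⬝ᵥ z)) ^ 2 =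
      ‖z‖⁻¹ ^ 2 * (z ⬝ᵥ B y *ᵥ z + (l ⬝ᵥ z) ^ 2) := by ring
  rw [h2] at h
  exact pos_of_mul_pos_right h (by positivity)

lemma isOpen_setOf_neg_plane {X : Type*} [TopologicalSpace X] {n : ℕ}
    {B : X → Matrix (Fin n) (Fin n) ℝ} (hB : Continuous B) :
    IsOpen {x | ∃ a b : Fin n → ℝ, a ⬝ᵥ B x *ᵥ a < 0 ∧
      (a ⬝ᵥ B x *ᵥ b) ^ 2 < (a ⬝ᵥ B x *ᵥ a) * (b ⬝ᵥ B x *ᵥ b)} := by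
  simp only [Set.ofPred_exists]
  refine isOpen_iUnion fun a => isOpen_iUnion fun b => ?_
  have h : ∀ a b : Fin n → ℝ, Continuous fun x => a ⬝ᵥ B x *ᵥ b := fun a b =>
    continuous_const.dotProduct (hB.matrix_mulVec continuous_const)
  exact (isOpen_lt (h a a) continuous_const).inter
    (isOpen_lt ((h a b).pow 2) ((h a a).mul (h b b)))

lemma exists_neg_plane_of_frame {n : ℕ} {B V : Matrix (Fin n) (Fin n) ℝ} {k : Fin n → ℝ}
    (hVB : Vᵀ * B * V = diagonal k) {i j : Fin n} (hij : i ≠ j) (hi : k i < 0) (hj : k j < 0) :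
    ∃ a b : Fin n → ℝ, a ⬝ᵥ B *ᵥ a < 0 ∧
      (a ⬝ᵥ B *ᵥ b) ^ 2 < (a ⬝ᵥ B *ᵥ a) * (b ⬝ᵥ B *ᵥ b) := by
  have h : ∀ i j, V.col i ⬝ᵥ B *ᵥ V.col j = diagonal k i j := fun i j => by
    rw [← hVB, Matrix.mul_assoc]
    simp [Matrix.mul_apply, dotProduct, mulVec]
  refine ⟨V.col i, V.col j, ?_, ?_⟩
  · simpa [h]
  · simpa [h, hij] using mul_pos_of_neg_of_neg hi hj

lemma exists_posDef_add_sq_of_frame {n : ℕ} {B V : Matrix (Fin n) (Fin n) ℝ} {k : Fin n → ℝ}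
    (hV : IsUnit V) (hVB : Vᵀ * B * V = diagonal k) (i : Fin n) (hk : ∀ j, j ≠ i → 0 < k j) :
    ∃ l : Fin n → ℝ, ∀ z : Fin n → ℝ, z ≠ 0 → 0 < z ⬝ᵥ B *ᵥ z + (l ⬝ᵥ z) ^ 2 := by
  refine ⟨√(|k i| + 1) • V⁻¹.row i, fun z hz => ?_⟩
  have hdet : IsUnit V.det := (isUnit_iff_isUnit_det _).mp hV
  obtain ⟨y, rfl⟩ : ∃ y, V *ᵥ y = z := ⟨V⁻¹ *ᵥ z, by simp [mulVec_mulVec, mul_nonsing_inv _ hdet]⟩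
  have hy : y ≠ 0 := by rintro rfl; simp at hz
  have h1 : V *ᵥ y ⬝ᵥ B *ᵥ V *ᵥ y = ∑ j, k j * y j ^ 2 := by
    rw [dotProduct_comm, dotProduct_mulVec, ← mulVec_transpose, mulVec_mulVec,
      mulVec_mulVec, hVB]
    simp [dotProduct, mulVec_diagonal, sq, mul_assoc]
  have h2 : V⁻¹.row i ⬝ᵥ V *ᵥ y = y i := by
    have := congrFun (mulVec_mulVec y V⁻¹ V) i
    rwa [nonsing_inv_mul _ hdet, one_mulVec] at this
  rw [h1, smul_dotProduct, h2, smul_eq_mul, mul_pow, Real.sq_sqrt (by positivity),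
    ← sum_erase_add _ _ (mem_univ i)]
  have hi : 0 < k i + (|k i| + 1) := by linarith [neg_abs_le (k i)]
  have hnn : ∀ j ∈ univ.erase i, 0 ≤ k j * y j ^ 2 := fun j hj =>
    mul_nonneg (hk j (ne_of_mem_erase hj)).le (sq_nonneg _)
  by_cases hyi : y i = 0
  · obtain ⟨j, hj⟩ := Function.ne_iff.mp hy
    have hji : j ≠ i := by rintro rfl; exact hj hyi
    have := sum_pos' hnn ⟨j, mem_erase.mpr ⟨hji, mem_univ j⟩,
      mul_pos (hk j hji) (sq_pos_of_ne_zero hj)⟩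
    simpa [hyi] using this
  · have := sum_nonneg hnn
    have : 0 < (k i + (|k i| + 1)) * y i ^ 2 := by positivity
    linarith

lemma IsLocalMax.secondDeriv_nonpos {p p' : ℝ → ℝ} {t c : ℝ} (hmax : IsLocalMax p t)
    (hp : ∀ᶠ s in 𝓝 t, HasDerivAt p (p' s) s) (hp' : HasDerivAt p' c t) : c ≤ 0 := by
  have heq : deriv p =ᶠ[𝓝 t] p' := hp.mono fun s hs => hs.deriv
  have hc : deriv (deriv p) t = c := by rw [heq.deriv_eq, hp'.deriv]
  by_contra! hpos
  have hmin : IsLocalMin p t := isLocalMin_of_deriv_deriv_pos (by rwa [hc]) hmax.deriv_eq_zero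
    hp.self_of_nhds.continuousAt
  have hconst : p =ᶠ[𝓝 t] fun _ => p t := by
    filter_upwards [hmax, hmin] with s h1 h2 using le_antisymm h1 h2
  have h0 : deriv (deriv p) t = 0 := by
    rw [hconst.deriv.deriv_eq]; simp
  linarith

/-- The lower hemisphere of radius `r` pushed down until it touches the graph of `f` does so over
an interior point of the ball. -/
lemma exists_isMaxOn_add_hemisphere {E : Type*} [NormedAddCommGroup E] [NormedSpace ℝ E]
    [ProperSpace E] {f : E → ℝ} (hf : Differentiable ℝ f) {r : ℝ} (hr : 0 < r) :
    ∃ x ∈ ball (0 : E) r,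
      IsMaxOn (fun y => f y + √(r ^ 2 - ‖y‖ ^ 2)) (closedBall 0 r) x := by
  have hc : Continuous fun y => f y + √(r ^ 2 - ‖y‖ ^ 2) := by
    have := hf.continuous
    fun_prop
  obtain ⟨x, hx, hmax⟩ := (isCompact_closedBall (0 : E) r).exists_isMaxOn
    ⟨0, mem_closedBall_self hr.le⟩ hc.continuousOn
  refine ⟨x, ?_, hmax⟩
  rw [mem_closedBall_zero_iff] at hx
  rw [mem_ball_zero_iff]
  refine lt_of_le_of_ne hx fun hxr => ?_
  have hd : DifferentiableAt ℝ (fun t : ℝ => f ((1 - t) • x)) 0 := by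
    have := hf.comp (f := fun t : ℝ => (1 - t) • x) (by fun_prop)
    exact this 0
  obtain ⟨C, hC⟩ := hd.isBigO_sub.bound
  have hev : ∀ᶠ t : ℝ in 𝓝[>] 0, r ^ 2 ≤ C ^ 2 * t := by
    filter_upwards [nhdsWithin_le_nhds hC, Ioo_mem_nhdsGT one_pos] with t ht ⟨h0, h1⟩
    have hn : ‖(1 - t) • x‖ = (1 - t) * r := by
      rw [norm_smul, hxr, Real.norm_of_nonneg (by linarith)]
    have h2 := hmax (a := (1 - t) • x) (by
      rw [mem_closedBall_zero_iff, hn]; nlinarith)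
    simp only [sub_zero, one_smul, Real.norm_eq_abs, abs_of_pos h0, Set.mem_ofPred_eq, hn, hxr,
      sub_self, Real.sqrt_zero, add_zero] at ht h2
    have h3 : r * √t ≤ √(r ^ 2 - ((1 - t) * r) ^ 2) := by
      refine Real.le_sqrt_of_sq_le ?_
      rw [mul_pow, Real.sq_sqrt h0.le]
      nlinarith [mul_pos (mul_pos hr hr) (mul_pos h0 (sub_pos.mpr h1))]
    have h4 : r * √t ≤ C * t := by linarith [neg_abs_le (f ((1 - t) • x) - f x)]
    have h5 : (r * √t) ^ 2 ≤ (C * t) ^ 2 := pow_le_pow_left₀ (by positivity) h4 2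
    rw [mul_pow, Real.sq_sqrt h0.le] at h5
    refine le_of_mul_le_mul_right (a := t) ?_ h0
    linarith
  have hlim : Tendsto (fun t : ℝ => C ^ 2 * t) (𝓝[>] 0) (𝓝 0) := by
    have : Tendsto (fun t : ℝ => C ^ 2 * t) (𝓝 0) (𝓝 (C ^ 2 * 0)) :=
      (continuous_const.mul continuous_id).tendsto 0
    rw [mul_zero] at this
    exact this.mono_left nhdsWithin_le_nhds
  have := ge_of_tendsto hlim hev
  nlinarith

/-- First and second order conditions along a line at a contact point with a hemisphere. -/
lemma hemisphere_contact_conditions {E : Type*} [NormedAddCommGroup E] [InnerProductSpace ℝ E]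
    {f : E → ℝ} (hf : ContDiff ℝ 2 f) {r : ℝ} {x : E} (hx : x ∈ ball (0 : E) r)
    (hmax : IsMaxOn (fun y => f y + √(r ^ 2 - ‖y‖ ^ 2)) (closedBall 0 r) x) (v : E) :
    fderiv ℝ f x v = inner ℝ x v / √(r ^ 2 - ‖x‖ ^ 2) ∧
    fderiv ℝ (fderiv ℝ f) x v v ≤
      (‖v‖ ^ 2 + (inner ℝ x v / √(r ^ 2 - ‖x‖ ^ 2)) ^ 2) / √(r ^ 2 - ‖x‖ ^ 2) := by
  set s := √(r ^ 2 - ‖x‖ ^ 2) with hs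
  set m := inner ℝ x v
  have hpos : 0 < r ^ 2 - ‖x‖ ^ 2 := by
    rw [mem_ball_zero_iff] at hx; nlinarith [norm_nonneg x]
  have hspos : 0 < s := Real.sqrt_pos.mpr hpos
  let ρ : ℝ → ℝ := fun t => r ^ 2 - ‖x‖ ^ 2 - 2 * m * t - ‖v‖ ^ 2 * t ^ 2
  have hρ0 : ρ 0 = r ^ 2 - ‖x‖ ^ 2 := by simp [ρ]
  have hρ : ∀ t, r ^ 2 - ‖x + t • v‖ ^ 2 = ρ t := fun t => by
    rw [norm_add_sq_real, inner_smul_right, norm_smul, mul_pow, Real.norm_eq_abs, sq_abs]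
    ring
  have hρd : ∀ t, HasDerivAt ρ (-2 * m - 2 * ‖v‖ ^ 2 * t) t := fun t => by
    have := (((hasDerivAt_id t).const_mul (2 * m)).const_sub (r ^ 2 - ‖x‖ ^ 2)).sub
      ((hasDerivAt_pow 2 t).const_mul (‖v‖ ^ 2))
    refine this.congr_deriv ?_
    simp; ring
  have hline : ∀ t : ℝ, HasDerivAt (fun t : ℝ => x + t • v) v t := fun t => by
    simpa using ((hasDerivAt_id t).smul_const v).const_add x
  have hsqrt : ∀ t, 0 < ρ t →
      HasDerivAt (fun t => √(ρ t)) ((-2 * m - 2 * ‖v‖ ^ 2 * t) / (2 * √(ρ t))) t :=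
    fun t ht => (hρd t).sqrt ht.ne'
  let p : ℝ → ℝ := fun t => f (x + t • v) + √(ρ t)
  let p' : ℝ → ℝ := fun t =>
    fderiv ℝ f (x + t • v) v + (-2 * m - 2 * ‖v‖ ^ 2 * t) / (2 * √(ρ t))
  have hp : ∀ t, 0 < ρ t → HasDerivAt p (p' t) t := fun t ht =>
    (((hf.differentiable (by norm_num)) (x + t • v)).hasFDerivAt.comp_hasDerivAt t (hline t)).add
      (hsqrt t ht)
  have hpev : ∀ᶠ t in 𝓝 0, HasDerivAt p (p' t) t := by
    filter_upwards [(hρd 0).continuousAt.eventually (lt_mem_nhds (hρ0 ▸ hpos))] with t ht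
      using hp t ht
  have hlocmax : IsLocalMax p 0 := by
    have hnhds : ∀ᶠ t : ℝ in 𝓝 0, x + t • v ∈ ball (0 : E) r :=
      (hline 0).continuousAt.eventually (isOpen_ball.mem_nhds (by simpa using hx))
    filter_upwards [hnhds] with t ht
    have := hmax (ball_subset_closedBall ht)
    simp only [Set.mem_ofPred_eq, hρ] at this
    simpa [p, hρ0] using this
  have hp'd : HasDerivAt p' (fderiv ℝ (fderiv ℝ f) x v v +
      ((-2 * ‖v‖ ^ 2) * (2 * s) - (-2 * m) * (2 * (-2 * m / (2 * s)))) / (2 * s) ^ 2) 0 := by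
    have h1 : HasDerivAt (fun t : ℝ => fderiv ℝ f (x + t • v) v)
        (fderiv ℝ (fderiv ℝ f) x v v) 0 := by
      have hd : HasFDerivAt (fderiv ℝ f) (fderiv ℝ (fderiv ℝ f) x) (x + (0 : ℝ) • v) := by
        rw [zero_smul, add_zero]
        exact ((hf.fderiv_right (m := 1) (by norm_num)).differentiable (by norm_num) x).hasFDerivAt
      have hcomp : HasDerivAt (fun t : ℝ => fderiv ℝ f (x + t • v)) (fderiv ℝ (fderiv ℝ f) x v) 0 :=
        hd.comp_hasDerivAt (0 : ℝ) (hline 0)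
      exact (ContinuousLinearMap.apply ℝ ℝ v).hasFDerivAt.comp_hasDerivAt (0 : ℝ) hcomp
    have h2 : HasDerivAt (fun t : ℝ => -2 * m - 2 * ‖v‖ ^ 2 * t) (-2 * ‖v‖ ^ 2) 0 := by
      simpa using ((hasDerivAt_id (0 : ℝ)).const_mul (2 * ‖v‖ ^ 2)).const_sub (-2 * m)
    have h3 := (hsqrt 0 (hρ0 ▸ hpos)).const_mul 2
    have h4 := h2.div h3 (by rw [hρ0, ← hs]; positivity)
    refine (h1.add h4).congr_deriv ?_
    simp [hρ0, ← hs]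
  have hfirst := hlocmax.hasDerivAt_eq_zero (hp 0 (hρ0 ▸ hpos))
  have hsecond := hlocmax.secondDeriv_nonpos hpev hp'd
  constructor
  · simp only [p', hρ0, ← hs, zero_smul, add_zero, mul_zero, sub_zero] at hfirst
    field_simp at hfirst ⊢
    linarith
  · have : ((-2 * ‖v‖ ^ 2) * (2 * s) - (-2 * m) * (2 * (-2 * m / (2 * s)))) / (2 * s) ^ 2 =
        -((‖v‖ ^ 2 + (m / s) ^ 2) / s) := by
      field_simp; ring
    linarith

lemma exists_forall_eigenvalue_le {n : ℕ} {f : EuclideanSpace ℝ (Fin n) → ℝ}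
    (hf : ContDiff ℝ 2 f) {r : ℝ} (hr : 0 < r) :
    ∃ x ∈ closedBall (0 : EuclideanSpace ℝ (Fin n)) r, ∀ (k : ℝ) (v : Fin n → ℝ), v ≠ 0 →
      shapeOp n f x *ᵥ v = k • v → k ≤ 1 / r := by
  obtain ⟨x, hx, hmax⟩ := exists_isMaxOn_add_hemisphere (hf.differentiable (by norm_num)) hr
  refine ⟨x, ball_subset_closedBall hx, fun k v hv hk => ?_⟩
  have hcontact := hemisphere_contact_conditions hf hx hmax
  set s := √(r ^ 2 - ‖x‖ ^ 2) with hs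
  have hpos : 0 < r ^ 2 - ‖x‖ ^ 2 := by
    rw [mem_ball_zero_iff] at hx; nlinarith [norm_nonneg x]
  have hspos : 0 < s := Real.sqrt_pos.mpr hpos
  have hgrad : ∀ w : Fin n → ℝ, grad n f x ⬝ᵥ w = inner ℝ x (WithLp.toLp 2 w) / s := fun w => by
    rw [← (hcontact _).1, fderiv_eq_grad_dotProduct]
  have hG : 1 + gradSq n f x = (r / s) ^ 2 := by
    have h1 : grad n f x ⬝ᵥ x.ofLp = ‖x‖ ^ 2 / s := by
      rw [hgrad, WithLp.toLp_ofLp, real_inner_self_eq_norm_sq]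
    have h2 : gradSq n f x = (grad n f x ⬝ᵥ x.ofLp) / s := by
      rw [gradSq_eq_dotProduct, hgrad]
      simp [EuclideanSpace.inner_eq_star_dotProduct]
    have h3 : s ^ 2 = r ^ 2 - ‖x‖ ^ 2 := Real.sq_sqrt hpos.le
    rw [h2, h1]
    field_simp
    linarith
  have hnorm : ‖WithLp.toLp 2 v‖ ^ 2 = v ⬝ᵥ v := by
    rw [EuclideanSpace.real_norm_sq_eq]
    simp [dotProduct, sq]
  have hle := (hcontact (WithLp.toLp 2 v)).2
  rw [fderiv_fderiv_eq_hess hf, hess_eigenvector hk, hG, Real.sqrt_sq (by positivity), hnorm,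
    ← hgrad] at hle
  have hq : 0 < v ⬝ᵥ v + (grad n f x ⬝ᵥ v) ^ 2 := by
    have : 0 < v ⬝ᵥ v := by simpa using dotProduct_star_self_pos_iff.mpr hv
    positivity
  set q := v ⬝ᵥ v + (grad n f x ⬝ᵥ v) ^ 2
  rw [le_div_iff₀ hr]
  have h : (k * r) * (q / s) ≤ 1 * (q / s) := by
    calc (k * r) * (q / s) = r / s * k * q := by ring
      _ ≤ q / s := hle
      _ = _ := (one_mul _).symm
  exact le_of_mul_le_mul_right h (by positivity)

/-- On the closed ball, either at every point at least two principal curvatures are negative, or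
at every point at least two are positive. -/
lemma two_negative_or_two_positive {n : ℕ} (hn : 3 ≤ n) {f : EuclideanSpace ℝ (Fin n) → ℝ}
    (hf : ContDiff ℝ 2 f) {r : ℝ}
    (hne : ∀ x ∈ closedBall (0 : EuclideanSpace ℝ (Fin n)) r, ∀ v : Fin n → ℝ, v ≠ 0 →
      shapeOp n f x *ᵥ v ≠ 0) :
    (∀ x ∈ closedBall (0 : EuclideanSpace ℝ (Fin n)) r,
      ∃ k : Fin n → ℝ, (∃ v : Fin n → Fin n → ℝ,
        ∀ i, v i ≠ 0 ∧ shapeOp n f x *ᵥ v i = k i • v i) ∧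
        (shapeOp n f x).trace = ∑ i, k i ∧ normA n f x = √(∑ i, k i ^ 2) ∧
        ∃ a b, a ≠ b ∧ k a < 0 ∧ k b < 0) ∨
    (∀ x ∈ closedBall (0 : EuclideanSpace ℝ (Fin n)) r,
      ∃ k : Fin n → ℝ, (∃ v : Fin n → Fin n → ℝ,
        ∀ i, v i ≠ 0 ∧ shapeOp n f x *ᵥ v i = k i • v i) ∧
        (shapeOp n f x).trace = ∑ i, k i ∧ normA n f x = √(∑ i, k i ^ 2) ∧
        ∃ a b, a ≠ b ∧ 0 < k a ∧ 0 < k b) := by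
  have : NeZero n := ⟨by omega⟩
  set N := {x | ∃ a b : Fin n → ℝ, a ⬝ᵥ hess n f x *ᵥ a < 0 ∧
      (a ⬝ᵥ hess n f x *ᵥ b) ^ 2 < (a ⬝ᵥ hess n f x *ᵥ a) * (b ⬝ᵥ hess n f x *ᵥ b)}
  set P := {x | ∃ l : Fin n → ℝ, ∀ z : Fin n → ℝ, z ≠ 0 →
      0 < z ⬝ᵥ hess n f x *ᵥ z + (l ⬝ᵥ z) ^ 2}
  have hdisj : Disjoint N P := Set.disjoint_left.mpr fun x ⟨_, _, ha, hab⟩ ⟨_, hl⟩ =>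
    not_neg_plane_of_posDef_add_sq (hess_transpose hf x) hl ha hab
  have hframe : ∀ x ∈ closedBall (0 : EuclideanSpace ℝ (Fin n)) r,
      ∃ k : Fin n → ℝ, (∃ v : Fin n → Fin n → ℝ,
        ∀ i, v i ≠ 0 ∧ shapeOp n f x *ᵥ v i = k i • v i) ∧
        (shapeOp n f x).trace = ∑ i, k i ∧ normA n f x = √(∑ i, k i ^ 2) ∧
        ((x ∈ N ∧ ∃ a b, a ≠ b ∧ k a < 0 ∧ k b < 0) ∨
          (x ∈ P ∧ ∃ a b, a ≠ b ∧ 0 < k a ∧ 0 < k b)) := fun x hx => by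
    obtain ⟨V, k, hV, hVB, he, ht, hq⟩ := exists_shapeOp_frame hf x
    refine ⟨k, ⟨V.col, he⟩, ht, hq, ?_⟩
    have hk0 : ∀ i, k i ≠ 0 := fun i h0 =>
      hne x hx _ (he i).1 (by rw [(he i).2, h0, zero_smul])
    by_cases h : ∃ a b, a ≠ b ∧ k a < 0 ∧ k b < 0
    · obtain ⟨a, b, hab, ha, hb⟩ := h
      exact Or.inl ⟨exists_neg_plane_of_frame hVB hab ha hb, a, b, hab, ha, hb⟩
    · right
      obtain ⟨i, hi⟩ : ∃ i, ∀ j, j ≠ i → 0 < k j := by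
        by_cases hall : ∃ i, k i < 0
        · obtain ⟨i, hi⟩ := hall
          exact ⟨i, fun j hji => lt_of_le_of_ne
            (not_lt.mp fun hj => h ⟨j, i, hji, hj, hi⟩) (hk0 j).symm⟩
        · push Not at hall
          exact ⟨0, fun j _ => lt_of_le_of_ne (hall j) (hk0 j).symm⟩
      refine ⟨exists_posDef_add_sq_of_frame hV hVB i hi, ?_⟩
      have hcard : 1 < (univ.erase i).card := by
        rw [card_erase_of_mem (mem_univ i), card_univ, Fintype.card_fin]; omega
      obtain ⟨a, ha, b, hb, hab⟩ := one_lt_card.mp hcard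
      exact ⟨a, b, hab, hi a (ne_of_mem_erase ha), hi b (ne_of_mem_erase hb)⟩
  have hcover : closedBall (0 : EuclideanSpace ℝ (Fin n)) r ⊆ N ∪ P := fun x hx => by
    obtain ⟨_, -, -, -, h | h⟩ := hframe x hx
    exacts [Or.inl h.1, Or.inr h.1]
  rcases (convex_closedBall (0 : EuclideanSpace ℝ (Fin n)) r).isPreconnected.subset_or_subset
    (isOpen_setOf_neg_plane (continuous_hess hf)) (isOpen_setOf_posDef_add_sq (continuous_hess hf))
    hdisj hcover with hsub | hsub
  · refine Or.inl fun x hx => ?_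
    obtain ⟨k, hv, ht, hq, h | h⟩ := hframe x hx
    · exact ⟨k, hv, ht, hq, h.2⟩
    · exact (Set.disjoint_left.mp hdisj (hsub hx) h.1).elim
  · refine Or.inr fun x hx => ?_
    obtain ⟨k, hv, ht, hq, h | h⟩ := hframe x hx
    · exact (Set.disjoint_left.mp hdisj h.1 (hsub hx)).elim
    · exact ⟨k, hv, ht, hq, h.2⟩

/-- **Theorem 3.** If a graph over the closed ball of radius `r` in `ℝⁿ`, `n ≥ 3`,
has negative Ricci curvature (every principal curvature `k` at every point
satisfies `k (tr W - k) < 0`), then `inf |A| < 3(n-2)/r`. -/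
theorem inf_normA_lt_of_negative_ricci_closedBall
    (n : ℕ) (hn : 3 ≤ n) (r : ℝ) (hr : 0 < r)
    (f : EuclideanSpace ℝ (Fin n) → ℝ) (hf : ContDiff ℝ 2 f)
    (hRic : ∀ x ∈ closedBall (0 : EuclideanSpace ℝ (Fin n)) r,
      ∀ (k : ℝ) (v : Fin n → ℝ), v ≠ 0 → (shapeOp n f x).mulVec v = k • v →
        k * ((shapeOp n f x).trace - k) < 0) :
    sInf ((fun x => normA n f x) '' closedBall (0 : EuclideanSpace ℝ (Fin n)) r)
      < 3 * ((n : ℝ) - 2) / r := by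
  suffices h : ∃ x ∈ closedBall (0 : EuclideanSpace ℝ (Fin n)) r,
      normA n f x < 3 * ((n : ℝ) - 2) / r by
    obtain ⟨x, hx, hlt⟩ := h
    refine lt_of_le_of_lt (csInf_le ⟨0, ?_⟩ (Set.mem_image_of_mem _ hx)) hlt
    rintro _ ⟨y, -, rfl⟩
    exact Real.sqrt_nonneg _
  rw [div_eq_mul_one_div]
  have hne : ∀ x ∈ closedBall (0 : EuclideanSpace ℝ (Fin n)) r, ∀ v : Fin n → ℝ, v ≠ 0 →
      shapeOp n f x *ᵥ v ≠ 0 := fun x hx v hv h0 => by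
    simpa using hRic x hx 0 v hv (by simpa using h0)
  rcases two_negative_or_two_positive hn hf hne with h | h
  · obtain ⟨x, hx, hle⟩ := exists_forall_eigenvalue_le hf hr
    obtain ⟨k, ⟨v, hv⟩, ht, hq, a, b, hab, ha, hb⟩ := h x hx
    refine ⟨x, hx, ?_⟩
    rw [hq]
    exact sum_sq_lt_of_two_neg (one_div_pos.mpr hr) k (fun i => hle _ _ (hv i).1 (hv i).2)
      (fun i => ht ▸ hRic x hx _ _ (hv i).1 (hv i).2) hab ha hb
  · obtain ⟨x, hx, hle⟩ := exists_forall_eigenvalue_le (f := -f) hf.neg hr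
    obtain ⟨k, ⟨v, hv⟩, ht, hq, a, b, hab, ha, hb⟩ := h x hx
    refine ⟨x, hx, ?_⟩
    rw [hq]
    have := sum_sq_lt_of_two_neg (one_div_pos.mpr hr) (fun i => -k i)
      (fun i => hle _ _ (hv i).1 (by rw [shapeOp_neg, neg_mulVec, (hv i).2, neg_smul]))
      (fun i => by
        have := ht ▸ hRic x hx _ _ (hv i).1 (hv i).2
        rw [sum_neg_distrib]
        linarith) hab (neg_lt_zero.mpr ha) (neg_lt_zero.mpr hb)
    simpa using this
end

section
/- Let n ≥ 3, let 2 ≤ l ≤ n−1, and let k₁, …, kₙ be real numbers with kᵢ < 0 for 1 ≤ i ≤ l and kᵢ > 0 for l+1 ≤ i ≤ n. Suppose that for every i with 1 ≤ i ≤ l one has kᵢ·(Σ_{j≠i} kⱼ) < 0. Then l·(Σ_{j=l+1}^{n} kⱼ) > (l−1)·(Σ_{m=1}^{l} |k_m|). -/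
open Finset

/-- If `kᵢ < 0` for `i < l`, `kᵢ > 0` for `i ≥ l` with `2 ≤ l ≤ n-1`, `n ≥ 3`, and
the Ricci curvature is negative in the negative principal directions, i.e.
`kᵢ·(Σ_{j≠i} kⱼ) < 0` for every `i < l`, then
`l·(Σ_{j ≥ l} kⱼ) > (l-1)·(Σ_{m < l} |k_m|)`. -/
theorem sum_positive_gt_of_negative_ricci
    (n : ℕ) (hn : 3 ≤ n) (l : ℕ) (hl2 : 2 ≤ l) (hl : l ≤ n - 1) (k : Fin n → ℝ)
    (hneg : ∀ i : Fin n, (i : ℕ) < l → k i < 0)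
    (hpos : ∀ i : Fin n, l ≤ (i : ℕ) → 0 < k i)
    (hRic : ∀ i : Fin n, (i : ℕ) < l → k i * ((∑ j, k j) - k i) < 0) :
    (l : ℝ) * (∑ j ∈ univ.filter (fun j : Fin n => l ≤ (j : ℕ)), k j)
      > ((l : ℝ) - 1) * (∑ m ∈ univ.filter (fun m : Fin n => (m : ℕ) < l), |k m|) := by
  have hcard : #(univ.filter (fun m : Fin n => (m : ℕ) < l)) = l := by
    rw [Fin.card_filter_val_lt]
    omega
  have habs : ∑ m ∈ univ.filter (fun m : Fin n => (m : ℕ) < l), |k m|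
      = -∑ m ∈ univ.filter (fun m : Fin n => (m : ℕ) < l), k m := by
    rw [← sum_neg_distrib]
    exact sum_congr rfl fun i hi => abs_of_neg (hneg i (mem_filter.1 hi).2)
  have hsplit := sum_filter_add_sum_filter_not univ (fun m : Fin n => (m : ℕ) < l) k
  simp only [not_lt] at hsplit
  have hsum : 0 < ∑ i ∈ univ.filter (fun m : Fin n => (m : ℕ) < l), ((∑ j, k j) - k i) := by
    refine sum_pos (fun i hi => ?_) (card_pos.1 (by omega))
    have hi' := (mem_filter.1 hi).2
    exact pos_of_mul_neg_right (hRic i hi') (hneg i hi').le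
  rw [sum_sub_distrib, sum_const, hcard, nsmul_eq_mul, ← hsplit] at hsum
  rw [habs]
  linarith
end

section
/- Let n ≥ 3, r > 0, let 2 ≤ l ≤ n−1, and let k₁, …, kₙ be real numbers with kᵢ < 0 for 1 ≤ i ≤ l, kᵢ > 0 for l+1 ≤ i ≤ n, and kᵢ ≤ 1/r for all i. Suppose that for every i with 1 ≤ i ≤ l one has kᵢ·(Σ_{j≠i} kⱼ) < 0. Then Σ_{m=1}^{n} |k_m| < 3(n−2)/r, and consequently √(Σ_{m=1}^{n} k_m²) < 3(n−2)/r. -/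
open Finset

/-- The sum of the positive parts (doubled) is controlled by an upper bound on the entries
when two of the entries are nonpositive. -/
theorem sum_abs_add_self_le {ι : Type*} [Fintype ι] [DecidableEq ι] {k : ι → ℝ} {c : ℝ}
    (hc : 0 ≤ c) (hk : ∀ i, k i ≤ c) {a b : ι} (hab : a ≠ b) (ha : k a ≤ 0) (hb : k b ≤ 0) :
    ∑ m, (|k m| + k m) ≤ ((Fintype.card ι : ℝ) - 2) * (2 * c) := by
  have h : ∑ m ∈ ({a, b} : Finset ι)ᶜ, (|k m| + k m) ≤ #({a, b} : Finset ι)ᶜ • (2 * c) := by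
    refine sum_le_card_nsmul _ _ _ fun m _ => ?_
    rcases abs_cases (k m) with h | h <;> linarith [hk m]
  have hcard : (#({a, b} : Finset ι)ᶜ : ℝ) = (Fintype.card ι : ℝ) - 2 := by
    rw [eq_sub_iff_add_eq, ← card_compl_add_card {a, b}, card_pair hab]
    push_cast
    rfl
  rw [nsmul_eq_mul, hcard] at h
  rw [← sum_compl_add_sum {a, b}, sum_pair hab, abs_of_nonpos ha, abs_of_nonpos hb]
  linarith

theorem neg_two_mul_add_le_sum_abs_sub_self {ι : Type*} [Fintype ι] [DecidableEq ι]
    (k : ι → ℝ) {a b : ι} (hab : a ≠ b) :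
    -2 * (k a + k b) ≤ ∑ m, (|k m| - k m) := by
  have h : ∑ m ∈ ({a, b} : Finset ι), (|k m| - k m) ≤ ∑ m, (|k m| - k m) :=
    sum_le_sum_of_subset_of_nonneg (subset_univ _)
      fun m _ _ => sub_nonneg.2 (le_abs_self _)
  rw [sum_pair hab] at h
  linarith [neg_abs_le (k a), neg_abs_le (k b)]

theorem sqrt_sum_sq_le_sum_abs {ι : Type*} (s : Finset ι) (k : ι → ℝ) :
    √(∑ m ∈ s, k m ^ 2) ≤ ∑ m ∈ s, |k m| := by
  refine Real.sqrt_le_iff.2 ⟨sum_nonneg fun m _ => abs_nonneg _, ?_⟩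
  simpa only [sq_abs] using sum_sq_le_sq_sum_of_nonneg (s := s) (f := fun m => |k m|)
    fun m _ => abs_nonneg _

/-- If `kᵢ < 0` for `i < l`, `kᵢ > 0` for `i ≥ l` with `2 ≤ l ≤ n-1`, `n ≥ 3`,
all `kᵢ ≤ 1/r` with `r > 0`, and `kᵢ·(Σ_{j≠i} kⱼ) < 0` for every `i < l`
(negative Ricci curvature in the negative principal directions), then
`Σ |k_m| < 3(n-2)/r`, and consequently `√(Σ k_m²) < 3(n-2)/r`. -/
theorem sum_abs_lt_of_negative_ricci
    (n : ℕ) (hn : 3 ≤ n) (r : ℝ) (hr : 0 < r)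
    (l : ℕ) (hl2 : 2 ≤ l) (hl : l ≤ n - 1) (k : Fin n → ℝ)
    (hneg : ∀ i : Fin n, (i : ℕ) < l → k i < 0)
    (hpos : ∀ i : Fin n, l ≤ (i : ℕ) → 0 < k i)
    (hbound : ∀ i : Fin n, k i ≤ 1 / r)
    (hRic : ∀ i : Fin n, (i : ℕ) < l → k i * ((∑ j, k j) - k i) < 0) :
    (∑ m, |k m|) < 3 * ((n : ℝ) - 2) / r ∧
      Real.sqrt (∑ m, k m ^ 2) < 3 * ((n : ℝ) - 2) / r := by
  have hT : ∑ m, |k m| < 3 * ((n : ℝ) - 2) / r := by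
    let a : Fin n := ⟨0, by omega⟩
    let b : Fin n := ⟨1, by omega⟩
    have hab : a ≠ b := by simp [a, b]
    have ha : k a < 0 := hneg a (by simp only [a]; omega)
    have hb : k b < 0 := hneg b (by simp only [b]; omega)
    have hRa := pos_of_mul_neg_right (hRic a (by simp only [a]; omega)) ha.le
    have hRb := pos_of_mul_neg_right (hRic b (by simp only [b]; omega)) hb.le
    have hadd := sum_abs_add_self_le (by positivity) hbound hab ha.le hb.le
    have hsub := neg_two_mul_add_le_sum_abs_sub_self k hab
    rw [sum_add_distrib, Fintype.card_fin] at hadd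
    rw [sum_sub_distrib] at hsub
    have hrw : 3 * ((n : ℝ) - 2) / r = 3 / 2 * (((n : ℝ) - 2) * (2 * (1 / r))) := by ring
    rw [hrw]
    linarith
  exact ⟨hT, (sqrt_sum_sq_le_sum_abs univ k).trans_lt hT⟩
end

section
/- Let n ≥ 2, r > 0, and let k₁, …, kₙ be real numbers with kᵢ ≤ 1/r for every i and Σ_{i=1}^{n} kᵢ ≥ 0. Then Σ_{i=1}^{n} kᵢ² ≤ n(n−1)/r²; in particular Σ_{i=1}^{n} kᵢ² < n²/r². -/
/-- If real numbers indexed by a finset `s` with at least two elements are bounded above by `a`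
and have nonnegative sum, then the sum of their squares is at most `#s (#s - 1) a²`. -/
theorem Finset.sum_sq_le_card_mul_of_le_of_sum_nonneg {ι : Type*} (s : Finset ι) (hs : 2 ≤ s.card)
    {a : ℝ} {k : ι → ℝ} (hk : ∀ i ∈ s, k i ≤ a) (hsum : 0 ≤ ∑ i ∈ s, k i) :
    ∑ i ∈ s, k i ^ 2 ≤ s.card * (s.card - 1) * a ^ 2 := by
  have hn : (2 : ℝ) ≤ s.card := by exact_mod_cast hs
  have hx : ∀ i ∈ s, 0 ≤ a - k i := fun i hi => sub_nonneg.mpr (hk i hi)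
  set T := ∑ i ∈ s, (a - k i) with hT
  have hT0 : 0 ≤ T := Finset.sum_nonneg hx
  have hTle : T ≤ s.card * a := by
    rw [hT, Finset.sum_sub_distrib, Finset.sum_const, nsmul_eq_mul]
    linarith
  have ha : 0 ≤ a := nonneg_of_mul_nonneg_right (hT0.trans hTle) (by linarith)
  have hsq : ∑ i ∈ s, (a - k i) ^ 2 ≤ T ^ 2 :=
    Finset.sum_sq_le_sq_sum_of_nonneg hx
  calc ∑ i ∈ s, k i ^ 2 = s.card * a ^ 2 - 2 * a * T + ∑ i ∈ s, (a - k i) ^ 2 := by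
        rw [hT, Finset.mul_sum, ← nsmul_eq_mul, ← Finset.sum_const, ← Finset.sum_sub_distrib,
          ← Finset.sum_add_distrib]
        exact Finset.sum_congr rfl fun i _ => by ring
    _ ≤ s.card * a ^ 2 + T * (T - 2 * a) := by linarith
    _ ≤ s.card * a ^ 2 + s.card * a * (s.card * a - 2 * a) := by
        have h2 : 0 ≤ s.card * a - 2 * a := by nlinarith
        have h3 : T * (T - 2 * a) ≤ T * (s.card * a - 2 * a) := by gcongr
        have h4 : T * (s.card * a - 2 * a) ≤ s.card * a * (s.card * a - 2 * a) := by gcongr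
        linarith
    _ = s.card * (s.card - 1) * a ^ 2 := by ring

/-- If `k₁, …, kₙ` satisfy `kᵢ ≤ 1/r` for all `i` (with `r > 0`) and `Σ kᵢ ≥ 0`
(nonnegative mean curvature), then `Σ kᵢ² ≤ n(n-1)/r²`; in particular
`Σ kᵢ² < n²/r²`. -/
theorem sum_sq_le_of_bounded_and_nonneg_sum
    (n : ℕ) (hn : 2 ≤ n) (r : ℝ) (hr : 0 < r) (k : Fin n → ℝ)
    (hbound : ∀ i, k i ≤ 1 / r) (hsum : 0 ≤ ∑ i, k i) :
    (∑ i, k i ^ 2) ≤ (n : ℝ) * ((n : ℝ) - 1) / r ^ 2 ∧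
      (∑ i, k i ^ 2) < (n : ℝ) ^ 2 / r ^ 2 := by
  have hle : (∑ i, k i ^ 2) ≤ (n : ℝ) * ((n : ℝ) - 1) / r ^ 2 := by
    simpa [div_eq_mul_inv] using
      Finset.univ.sum_sq_le_card_mul_of_le_of_sum_nonneg (by simpa using hn)
        (fun i _ => hbound i) hsum
  refine ⟨hle, hle.trans_lt ?_⟩
  have hn0 : (0 : ℝ) < n := by positivity
  gcongr
  nlinarith
end
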